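/- arXiv:2504.16065 — 11 statements merged into one kernel-verified Lean document; each statement's English description precedes it below -/
import Mathlib

section
/- For every natural number k and every real number ε with 0 ≤ ε ≤ 0.4, the k-th Chebyshev polynomial of the first kind satisfies T_k(1 + ε) ≥ (1/2)·exp(k·√ε). -/
/-- For every natural number `k` and every real `ε` with `0 ≤ ε ≤ 0.4`,
the `k`-th Chebyshev polynomial of the first kind satisfies
`T_k(1 + ε) ≥ (1/2) · exp(k · √ε)`. -/
theorem chebyshev_eval_one_add_ge (k : ℕ) (ε : ℝ) (hε0 : 0 ≤ ε) (hε1 : ε ≤ 0.4) :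
    (Polynomial.Chebyshev.T ℝ (k : ℤ)).eval (1 + ε) ≥
      (1 / 2) * Real.exp ((k : ℝ) * Real.sqrt ε) := by
  have hs : Real.sqrt ε ^ 2 = ε := Real.sq_sqrt hε0
  have h1 : Real.cosh (Real.sqrt ε) ≤ 1 + ε := by
    have a := Real.cosh_le_exp_half_sq (Real.sqrt ε)
    rw [hs] at a
    have hp : 0 ≤ ε / 2 := by linarith
    have b := Real.abs_exp_sub_one_le (x := ε / 2) (by
      rw [abs_of_nonneg hp]
      norm_num at hε1
      linarith)
    rw [abs_of_nonneg hp] at b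
    have c := (abs_le.mp b).2
    linarith
  have h2 : Real.sqrt ε ≤ Real.arcosh (1 + ε) := by
    rw [← Real.arcosh_cosh (Real.sqrt_nonneg ε)]
    exact (Real.arcosh_le_arcosh (Real.cosh_pos _) (by linarith)).2 h1
  have h3 : (Polynomial.Chebyshev.T ℝ (k : ℤ)).eval (1 + ε)
      = Real.cosh ((k : ℝ) * Real.arcosh (1 + ε)) := by
    have h := Polynomial.Chebyshev.T_real_cosh (Real.arcosh (1 + ε)) (k : ℤ)
    rw [Real.cosh_arcosh (by linarith)] at h
    simpa using h
  have h4 : Real.exp ((k : ℝ) * Real.sqrt ε) ≤ Real.exp ((k : ℝ) * Real.arcosh (1 + ε)) :=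
    Real.exp_le_exp.2 (mul_le_mul_of_nonneg_left h2 (Nat.cast_nonneg k))
  rw [h3, Real.cosh_eq]
  have h5 := Real.exp_pos (-((k : ℝ) * Real.arcosh (1 + ε)))
  linarith
end

section
/- Let Δ ≥ 3 be an integer and let ε ∈ (0, 1/2]. Set d = ⌈3·√Δ·ln(1/ε)⌉ and define the univariate real function q(t) = T_d(t/Δ) / T_d((Δ+1)/Δ). Then q(Δ+1) = 1 and |q(t)| ≤ ε for every real t with −Δ ≤ t ≤ Δ. -/
/-- Let `Δ ≥ 3` be an integer, `ε ∈ (0, 1/2]`, `d = ⌈3·√Δ·ln(1/ε)⌉`, and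
`q(t) = T_d(t/Δ) / T_d((Δ+1)/Δ)` where `T_d` is the `d`-th Chebyshev polynomial of the first
kind.  Then `q(Δ+1) = 1` and `|q(t)| ≤ ε` for every real `t` with `−Δ ≤ t ≤ Δ`. -/
theorem chebyshev_ratio_bound (Δ : ℕ) (hΔ : 3 ≤ Δ) (ε : ℝ) (hε0 : 0 < ε) (hε1 : ε ≤ 1 / 2)
    (d : ℕ) (hd : d = ⌈3 * Real.sqrt (Δ : ℝ) * Real.log (1 / ε)⌉₊)
    (q : ℝ → ℝ)
    (hq : ∀ t : ℝ, q t =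
      (Polynomial.Chebyshev.T ℝ (d : ℤ)).eval (t / (Δ : ℝ)) /
        (Polynomial.Chebyshev.T ℝ (d : ℤ)).eval (((Δ : ℝ) + 1) / (Δ : ℝ))) :
    q ((Δ : ℝ) + 1) = 1 ∧ ∀ t : ℝ, -(Δ : ℝ) ≤ t → t ≤ (Δ : ℝ) → |q t| ≤ ε := by
  have hD : (3 : ℝ) ≤ (Δ : ℝ) := by exact_mod_cast hΔ
  have hD0 : (0 : ℝ) < (Δ : ℝ) := by linarith
  have hx : (1 : ℝ) ≤ ((Δ : ℝ) + 1) / (Δ : ℝ) := by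
    rw [le_div_iff₀ hD0]; linarith
  have hT1 := Polynomial.Chebyshev.one_le_eval_T_real (d : ℤ) hx
  have hT0 : 0 < (Polynomial.Chebyshev.T ℝ (d : ℤ)).eval (((Δ : ℝ) + 1) / (Δ : ℝ)) := by
    linarith
  refine ⟨by rw [hq]; exact div_self hT0.ne', ?_⟩
  intro t ht1 ht2
  have hnum : |(Polynomial.Chebyshev.T ℝ (d : ℤ)).eval (t / (Δ : ℝ))| ≤ 1 := by
    apply Polynomial.Chebyshev.abs_eval_T_real_le_one
    rw [abs_le]
    constructor
    · rw [le_div_iff₀ hD0]; linarith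
    · rw [div_le_iff₀ hD0]; linarith
  suffices hden : 1 / ε ≤ (Polynomial.Chebyshev.T ℝ (d : ℤ)).eval (((Δ : ℝ) + 1) / (Δ : ℝ)) by
    rw [hq, abs_div, abs_of_pos hT0, div_le_iff₀ hT0]
    rw [div_le_iff₀ hε0] at hden
    linarith
  set s : ℝ := Real.sqrt (Δ : ℝ) with hs
  have hs0 : 0 < s := Real.sqrt_pos.mpr hD0
  have hss : s ^ 2 = (Δ : ℝ) := Real.sq_sqrt hD0.le
  have hinv : 2 ≤ 1 / ε := by rw [le_div_iff₀ hε0]; linarith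
  have hinv0 : 0 < 1 / ε := by linarith
  set L : ℝ := Real.log (1 / ε) with hL
  have hexpL : Real.exp L = 1 / ε := Real.exp_log hinv0
  have hL0 : 0 ≤ L := Real.log_nonneg (by linarith)
  set θ : ℝ := Real.arcosh (((Δ : ℝ) + 1) / (Δ : ℝ)) with hθ
  have hcosh : Real.cosh θ = ((Δ : ℝ) + 1) / (Δ : ℝ) := Real.cosh_arcosh hx
  have hθ0 : 0 ≤ θ := Real.arcosh_nonneg hx
  have hexp : Real.exp (2 / (9 * (Δ : ℝ))) ≤ ((Δ : ℝ) + 1) / (Δ : ℝ) := by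
    have h1 : 1 - 2 / (9 * (Δ : ℝ)) ≤ Real.exp (-(2 / (9 * (Δ : ℝ)))) :=
      Real.one_sub_le_exp_neg _
    have h2 : (1 : ℝ) ≤ (((Δ : ℝ) + 1) / (Δ : ℝ)) * (1 - 2 / (9 * (Δ : ℝ))) := by
      have h3 : (((Δ : ℝ) + 1) / (Δ : ℝ)) * (1 - 2 / (9 * (Δ : ℝ)))
          = 1 + (7 * (Δ : ℝ) - 2) / (9 * (Δ : ℝ) ^ 2) := by
        field_simp; ring
      rw [h3]
      have : 0 ≤ (7 * (Δ : ℝ) - 2) / (9 * (Δ : ℝ) ^ 2) :=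
        div_nonneg (by linarith) (by positivity)
      linarith
    have h4 : (1 : ℝ) ≤ (((Δ : ℝ) + 1) / (Δ : ℝ)) * Real.exp (-(2 / (9 * (Δ : ℝ)))) :=
      h2.trans (mul_le_mul_of_nonneg_left h1 (by linarith))
    rw [Real.exp_neg, ← div_eq_mul_inv, le_div_iff₀ (Real.exp_pos _)] at h4
    linarith
  have hθ1 : 2 / (3 * s) ≤ θ := by
    have h1 : Real.cosh (2 / (3 * s)) ≤ Real.cosh θ := by
      rw [hcosh]
      refine (Real.cosh_le_exp_half_sq _).trans ?_
      have h2 : (2 / (3 * s)) ^ 2 / 2 = 2 / (9 * (Δ : ℝ)) := by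
        rw [← hss]; field_simp; norm_num
      rw [h2]; exact hexp
    rw [Real.cosh_le_cosh, abs_of_nonneg hθ0, abs_of_nonneg (by positivity)] at h1
    exact h1
  have hdl : 3 * s * L ≤ (d : ℝ) := by rw [hd]; exact Nat.le_ceil _
  have hdθ : 2 * L ≤ (d : ℝ) * θ := by
    have h1 : 3 * s * L * (2 / (3 * s)) ≤ (d : ℝ) * θ :=
      mul_le_mul hdl hθ1 (by positivity) (by positivity)
    have h2 : 3 * s * L * (2 / (3 * s)) = 2 * L := by field_simp
    linarith
  rw [← hcosh, Polynomial.Chebyshev.T_real_cosh, Real.cosh_eq]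
  have h1 : Real.exp (2 * L) ≤ Real.exp ((d : ℝ) * θ) := Real.exp_le_exp.mpr hdθ
  have h2 : Real.exp (2 * L) = (1 / ε) * (1 / ε) := by rw [two_mul, Real.exp_add, hexpL]
  have h3 := Real.exp_pos (-((d : ℝ) * θ))
  push_cast
  nlinarith
end

section
/- Let n ≥ 1, let T ⊆ [n], let σ ∈ {−1,1}^T, and define the conjunction c : {−1,1}^n → {−1,1} by c(x) = 1 if x_i = σ_i for every i ∈ T, and c(x) = −1 otherwise. Let Δ ≥ 3 be an integer and ε ∈ (0, 1/2]. Then there exists a real polynomial p in the n variables x_1, …, x_n of total degree at most ⌈3·√Δ·ln(2/ε)⌉ such that |p(x) − c(x)| ≤ ε for every x ∈ {−1,1}^n satisfying |{i ∈ T : x_i ≠ σ_i}| ≤ Δ. -/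
open scoped Classical in
lemma totalDegree_aeval_le_aux {n : ℕ} (q : Polynomial ℝ) (l : MvPolynomial (Fin n) ℝ)
    (hl : l.totalDegree ≤ 1) : (Polynomial.aeval l q).totalDegree ≤ q.natDegree := by
  rw [Polynomial.aeval_eq_sum_range]
  refine MvPolynomial.totalDegree_finsetSum_le ?_
  intro i hi
  refine (MvPolynomial.totalDegree_smul_le _ _).trans ?_
  refine (MvPolynomial.totalDegree_pow _ _).trans ?_
  have := Finset.mem_range.1 hi
  nlinarith

/-- Growth of the Chebyshev polynomial just outside the unit interval. -/
lemma cheb_growth_aux (D L : ℝ) (hD : 3 ≤ D) (hL : 2 * Real.log 2 ≤ L) (d : ℕ)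
    (hd : 3 * Real.sqrt D * L ≤ d) :
    Real.exp L ≤ (Polynomial.Chebyshev.T ℝ d).eval ((D + 1) / (D - 1)) := by
  have h1 : 1 ≤ (D + 1) / (D - 1) := by
    rw [le_div_iff₀ (by linarith)]; linarith
  set θ := Real.arcosh ((D + 1) / (D - 1)) with hθ
  have hc : Real.cosh θ = (D + 1) / (D - 1) := Real.cosh_arcosh h1
  have hθ0 : 0 ≤ θ := Real.arcosh_nonneg h1
  have hs : 0 < Real.sqrt D := Real.sqrt_pos.2 (by linarith)
  have hs2 : Real.sqrt D ^ 2 = D := Real.sq_sqrt (by linarith)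
  have hle : 1 / (2 * Real.sqrt D) ≤ θ := by
    have h2 : Real.cosh (1 / (2 * Real.sqrt D)) ≤ Real.cosh θ := by
      refine (Real.cosh_le_exp_half_sq _).trans ?_
      have e : (1 / (2 * Real.sqrt D)) ^ 2 / 2 = 1 / (8 * D) := by
        rw [div_pow, mul_pow, hs2]; field_simp; norm_num
      rw [e, hc]
      have h3 : 1 - 1 / (8 * D) ≤ Real.exp (-(1 / (8 * D))) := by
        have := Real.add_one_le_exp (-(1 / (8 * D))); linarith
      have h4 : (D - 1) / (D + 1) ≤ 1 - 1 / (8 * D) := by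
        rw [div_le_iff₀ (by linarith)]
        have : 1 / (8 * D) * (8 * D) = 1 := by field_simp
        have : 0 < 1 / (8 * D) := by positivity
        have : 1 / (8 * D) ≤ 1 / 8 := by
          rw [div_le_div_iff₀ (by linarith) (by norm_num)]; linarith
        nlinarith
      have h5 := h4.trans h3
      rw [Real.exp_neg] at h5
      have hp : 0 < (D - 1) / (D + 1) := div_pos (by linarith) (by linarith)
      have := (le_inv_comm₀ hp (Real.exp_pos _)).1 h5
      rwa [inv_div] at this
    rw [Real.cosh_le_cosh] at h2
    rwa [abs_of_nonneg (by positivity), abs_of_nonneg hθ0] at h2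
  have hlog : 0 < Real.log 2 := Real.log_pos (by norm_num)
  have hkey : L + Real.log 2 ≤ d * θ := by
    have h6 : 3 * Real.sqrt D * L * (1 / (2 * Real.sqrt D)) = 3 / 2 * L := by
      field_simp
    have h7 : 3 * Real.sqrt D * L * (1 / (2 * Real.sqrt D)) ≤ d * θ :=
      mul_le_mul hd hle (by positivity) (by positivity)
    linarith
  rw [← hc, Polynomial.Chebyshev.T_real_cosh, Real.cosh_eq]
  have h8 := Real.exp_le_exp.2 hkey
  rw [Real.exp_add, Real.exp_log (by norm_num)] at h8
  have h9 := Real.exp_pos (-(d * θ))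
  push_cast
  linarith

open scoped Classical in
/-- Let `n ≥ 1`, `T ⊆ [n]`, `σ ∈ {−1,1}^T`, and let
`c : {−1,1}^n → {−1,1}` be the conjunction `c(x) = 1` iff `x_i = σ_i` for all `i ∈ T`.
Let `Δ ≥ 3` and `ε ∈ (0, 1/2]`.  Then there is a real polynomial `p` in `x_1, …, x_n` of
total degree at most `⌈3·√Δ·ln(2/ε)⌉` with `|p(x) − c(x)| ≤ ε` for every `x ∈ {−1,1}^n`
falsifying at most `Δ` literals, i.e. with `|{i ∈ T : x_i ≠ σ_i}| ≤ Δ`. -/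
theorem conjunction_low_degree_approx_on_ball (n : ℕ) (hn : 1 ≤ n)
    (T : Finset (Fin n)) (σ : Fin n → ℝ) (hσ : ∀ i ∈ T, σ i = 1 ∨ σ i = -1)
    (c : (Fin n → ℝ) → ℝ)
    (hc : ∀ x : Fin n → ℝ, c x = if ∀ i ∈ T, x i = σ i then 1 else -1)
    (Δ : ℕ) (hΔ : 3 ≤ Δ) (ε : ℝ) (hε0 : 0 < ε) (hε1 : ε ≤ 1 / 2) :
    ∃ p : MvPolynomial (Fin n) ℝ,
      p.totalDegree ≤ ⌈3 * Real.sqrt (Δ : ℝ) * Real.log (2 / ε)⌉₊ ∧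
      ∀ x : Fin n → ℝ, (∀ i, x i = 1 ∨ x i = -1) →
        Set.ncard {i : Fin n | i ∈ T ∧ x i ≠ σ i} ≤ Δ →
        |MvPolynomial.eval x p - c x| ≤ ε := by
  set d := ⌈3 * Real.sqrt (Δ : ℝ) * Real.log (2 / ε)⌉₊ with hd
  have hD : (3 : ℝ) ≤ Δ := by exact_mod_cast hΔ
  have hL : 2 * Real.log 2 ≤ Real.log (2 / ε) := by
    have : 2 * Real.log 2 = Real.log (2 ^ 2) := by rw [Real.log_pow]; norm_num
    rw [this]
    apply Real.log_le_log (by norm_num)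
    rw [le_div_iff₀ hε0]; linarith
  have hg := cheb_growth_aux Δ _ hD hL d (Nat.le_ceil _)
  rw [Real.exp_log (by positivity)] at hg
  set M := (Polynomial.Chebyshev.T ℝ d).eval (((Δ : ℝ) + 1) / (Δ - 1)) with hM
  have hMpos : 0 < M := lt_of_lt_of_le (by positivity) hg
  let l : MvPolynomial (Fin n) ℝ := MvPolynomial.C (((Δ : ℝ) + 1) / (Δ - 1)) -
    ∑ i ∈ T, (MvPolynomial.C (1 / ((Δ : ℝ) - 1)) -
      MvPolynomial.C (σ i / ((Δ : ℝ) - 1)) * MvPolynomial.X i)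
  have hl : l.totalDegree ≤ 1 := by
    refine (MvPolynomial.totalDegree_sub _ _).trans (max_le (by simp) ?_)
    refine MvPolynomial.totalDegree_finsetSum_le fun i _ => ?_
    refine (MvPolynomial.totalDegree_sub _ _).trans (max_le (by simp) ?_)
    refine (MvPolynomial.totalDegree_mul _ _).trans (by simp)
  refine ⟨MvPolynomial.C (2 / M) * Polynomial.aeval l (Polynomial.Chebyshev.T ℝ d)
    - MvPolynomial.C 1, ?_, ?_⟩
  · refine (MvPolynomial.totalDegree_sub _ _).trans (max_le ?_ (by simp))
    refine (MvPolynomial.totalDegree_mul _ _).trans ?_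
    have := totalDegree_aeval_le_aux (Polynomial.Chebyshev.T ℝ d) l hl
    simpa using this
  · intro x hx hcard
    have hset : {i : Fin n | i ∈ T ∧ x i ≠ σ i} = ↑(T.filter fun i => x i ≠ σ i) := by
      ext i; simp
    rw [hset, Set.ncard_coe_finset] at hcard
    set k := (T.filter fun i => x i ≠ σ i).card with hk
    have hD1 : (0 : ℝ) < Δ - 1 := by linarith
    have hle : MvPolynomial.eval x l = ((Δ : ℝ) + 1 - 2 * k) / (Δ - 1) := by
      have hsum : ∑ i ∈ T, (1 / ((Δ : ℝ) - 1) - σ i / ((Δ : ℝ) - 1) * x i)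
          = 2 * k / (Δ - 1) := by
        have : ∀ i ∈ T, (1 / ((Δ : ℝ) - 1) - σ i / ((Δ : ℝ) - 1) * x i)
            = if x i ≠ σ i then 2 / ((Δ : ℝ) - 1) else 0 := by
          intro i hi
          rcases hσ i hi with h | h <;> rcases hx i with h' | h' <;> rw [h, h'] <;>
            norm_num <;> ring
        rw [Finset.sum_congr rfl this, ← Finset.sum_filter, Finset.sum_const, nsmul_eq_mul]
        ring
      simp only [l, map_sub, map_sum, map_mul, MvPolynomial.eval_C, MvPolynomial.eval_X]
      rw [hsum]; ring
    have hev : MvPolynomial.eval x (Polynomial.aeval l (Polynomial.Chebyshev.T ℝ d))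
        = (Polynomial.Chebyshev.T ℝ d).eval (MvPolynomial.eval x l) := by
      rw [Polynomial.Chebyshev.aeval_T, Polynomial.eval, Polynomial.hom_eval₂]
      rw [← Polynomial.Chebyshev.map_T (MvPolynomial.C : ℝ →+* MvPolynomial (Fin n) ℝ),
        Polynomial.eval₂_map, Polynomial.eval]
      congr 1
      ext; simp
    rw [map_sub, map_mul, hev, MvPolynomial.eval_C, MvPolynomial.eval_C, hle, hc]
    split_ifs with h
    · have hk0 : k = 0 := by
        rw [hk, Finset.card_eq_zero, Finset.filter_eq_empty_iff]
        intro i hi; simpa using h i hi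
      rw [hk0]
      simp only [Nat.cast_zero, mul_zero, sub_zero]
      rw [← hM, div_mul_cancel₀ _ hMpos.ne']
      norm_num
      linarith
    · have hk1 : 1 ≤ k := by
        push Not at h
        obtain ⟨i, hi, hne⟩ := h
        exact Finset.card_pos.2 ⟨i, by simp [hi, hne]⟩
      have hk1' : (1 : ℝ) ≤ k := by exact_mod_cast hk1
      have hk2 : (k : ℝ) ≤ Δ := by exact_mod_cast hcard
      have hb : |(Polynomial.Chebyshev.T ℝ d).eval (((Δ : ℝ) + 1 - 2 * k) / (Δ - 1))| ≤ 1 := by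
        apply Polynomial.Chebyshev.abs_eval_T_real_le_one
        rw [abs_le, le_div_iff₀ hD1, div_le_iff₀ hD1]
        constructor <;> linarith
      have : ∀ y : ℝ, 2 / M * y - 1 - -1 = 2 / M * y := fun y => by ring
      rw [this, abs_mul, abs_of_pos (by positivity)]
      have h2 : 2 / M ≤ ε := by
        rw [div_le_iff₀ hMpos]
        rw [div_le_iff₀ hε0] at hg
        linarith
      calc 2 / M * _ ≤ 2 / M * 1 := by gcongr
        _ ≤ ε := by linarith
end

section
/- Let X be a finite set, let D be a probability distribution on X × {−1,1}, let c : X → {−1,1}, let E ⊆ X with Pr_{(x,y)∼D}[x ∈ E] > 0, let ε ≥ 0, and let h' : X → {−1,1}. Assume (i) Pr_{(x,y)∼D}[x ∉ E and c(x) = 1 and y = 1] ≤ ε, and (ii) Pr_{(x,y)∼D}[h'(x) ≠ y | x ∈ E] ≤ Pr_{(x,y)∼D}[c(x) ≠ y | x ∈ E] + ε. Define h : X → {−1,1} by h(x) = h'(x) if x ∈ E and h(x) = −1 otherwise. Then Pr_{(x,y)∼D}[h(x) ≠ y] ≤ Pr_{(x,y)∼D}[c(x) ≠ y] + 2ε.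 -/
/-- (Patching lemma.)  `X` is a finite set, `D` a probability distribution on
`X × {−1,1}` (labels encoded as `Bool`, with `true = 1` and `false = −1`), `c : X → {−1,1}`,
`E ⊆ X` an event of positive probability, `ε ≥ 0`, and `h' : X → {−1,1}`.  If
(i) `Pr[x ∉ E ∧ c(x) = 1 ∧ y = 1] ≤ ε` and
(ii) `Pr[h'(x) ≠ y ∣ x ∈ E] ≤ Pr[c(x) ≠ y ∣ x ∈ E] + ε`,
then the hypothesis `h` that equals `h'` on `E` and `−1` (i.e. `false`) off `E` satisfies
`Pr[h(x) ≠ y] ≤ Pr[c(x) ≠ y] + 2ε`. -/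
theorem patching_hypothesis (X : Type*) [Fintype X] [DecidableEq X]
    (D : X × Bool → ℝ) (hD0 : ∀ z, 0 ≤ D z) (hD1 : ∑ z : X × Bool, D z = 1)
    (c : X → Bool) (E : Finset X) (ε : ℝ) (hε : 0 ≤ ε) (h' h : X → Bool)
    (hPE : 0 < ∑ z : X × Bool, if z.1 ∈ E then D z else 0)
    (hi : (∑ z : X × Bool, if z.1 ∉ E ∧ c z.1 = true ∧ z.2 = true then D z else 0) ≤ ε)
    (hii :
      (∑ z : X × Bool, if z.1 ∈ E ∧ h' z.1 ≠ z.2 then D z else 0) /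
          (∑ z : X × Bool, if z.1 ∈ E then D z else 0) ≤
        (∑ z : X × Bool, if z.1 ∈ E ∧ c z.1 ≠ z.2 then D z else 0) /
            (∑ z : X × Bool, if z.1 ∈ E then D z else 0) + ε)
    (hh : ∀ x : X, h x = if x ∈ E then h' x else false) :
    (∑ z : X × Bool, if h z.1 ≠ z.2 then D z else 0) ≤
      (∑ z : X × Bool, if c z.1 ≠ z.2 then D z else 0) + 2 * ε := by
  have key : (∑ z : X × Bool, if h z.1 ≠ z.2 then D z else 0) +
      (∑ z : X × Bool, if z.1 ∈ E ∧ c z.1 ≠ z.2 then D z else 0) ≤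
      (∑ z : X × Bool, if c z.1 ≠ z.2 then D z else 0) +
      (∑ z : X × Bool, if z.1 ∈ E ∧ h' z.1 ≠ z.2 then D z else 0) +
      (∑ z : X × Bool, if z.1 ∉ E ∧ c z.1 = true ∧ z.2 = true then D z else 0) := by
    rw [← Finset.sum_add_distrib, ← Finset.sum_add_distrib, ← Finset.sum_add_distrib]
    refine Finset.sum_le_sum fun z _ => ?_
    obtain ⟨x, y⟩ := z
    have hz := hD0 (x, y)
    have hx := hh x
    by_cases hE : x ∈ E
    · simp only [hE, if_true] at hx
      simp [hE, hx, add_comm]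
    · simp only [hE, if_false] at hx
      cases y <;> cases hc : c x <;> simp [hE, hx, hc, hz]
  have hP1 : (∑ z : X × Bool, if z.1 ∈ E then D z else 0) ≤ 1 := by
    rw [← hD1]
    refine Finset.sum_le_sum fun z _ => ?_
    split_ifs
    · exact le_rfl
    · exact hD0 z
  rw [div_add' _ _ _ hPE.ne', div_le_div_iff_of_pos_right hPE] at hii
  have := mul_le_mul_of_nonneg_left hP1 hε
  linarith
end

section
/- Let n ≥ 1 and r ≥ 1 be integers, let P be a probability distribution on {−1,1}^n, let ε ∈ (0,1), and let m = ⌈n/r⌉. Draw a¹, …, a^m independently from P, and let Const(ā) := {i ∈ [n] : a¹_i = a²_i = ⋯ = a^m_i}. Then with probability at least ε^m over the draw of a¹, …, a^m, we have Pr_{x∼P}[ |{i ∈ Const(ā) : x_i ≠ a¹_i}| ≤ r ] ≥ 1 − ε. -/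
/-- The set `C` of coordinates with base point `b` is useful. -/
def UsefulSet {n : ℕ} (P : (Fin n → Bool) → ℝ) (ε : ℝ) (r : ℕ) (b : Fin n → Bool)
    (C : Finset (Fin n)) : Prop :=
  1 - ε ≤ ∑ x : Fin n → Bool, (if (C.filter fun i => x i ≠ b i).card ≤ r then P x else 0)

theorem UsefulSet.mono {n : ℕ} {P : (Fin n → Bool) → ℝ} (hP0 : ∀ x, 0 ≤ P x) {ε : ℝ} {r : ℕ}
    {b : Fin n → Bool} {C D : Finset (Fin n)} (h : UsefulSet P ε r b C) (hD : D ⊆ C) :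
    UsefulSet P ε r b D := by
  unfold UsefulSet at *
  refine h.trans (Finset.sum_le_sum fun x _ => ?_)
  have hc := Finset.card_le_card (Finset.filter_subset_filter (fun i => x i ≠ b i) hD)
  by_cases h1 : (C.filter fun i => x i ≠ b i).card ≤ r
  · rw [if_pos h1, if_pos (hc.trans h1)]
  · rw [if_neg h1]
    split_ifs
    · exact hP0 x
    · exact le_rfl

theorem sum_prod_one {n : ℕ} (P : (Fin n → Bool) → ℝ) (hP1 : ∑ x : Fin n → Bool, P x = 1)
    (k : ℕ) : ∑ a : Fin k → (Fin n → Bool), ∏ j, P (a j) = 1 := by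
  rw [← Fintype.sum_pow, hP1, one_pow]

theorem sum_cons {n : ℕ} (k : ℕ) (f : (Fin (k+1) → (Fin n → Bool)) → ℝ) :
    ∑ a, f a = ∑ x, ∑ a : Fin k → (Fin n → Bool), f (Fin.cons x a) := by
  rw [← (Fin.consEquiv (fun _ : Fin (k+1) => (Fin n → Bool))).sum_comp, Fintype.sum_prod_type]
  rfl

open scoped Classical in
theorem useful_step {n r : ℕ} (P : (Fin n → Bool) → ℝ) (hP0 : ∀ x, 0 ≤ P x)
    (hP1 : ∑ x : Fin n → Bool, P x = 1) (ε : ℝ) (hε0 : 0 < ε) (hε1 : ε < 1)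
    (b : Fin n → Bool) (k : ℕ) : ∀ C : Finset (Fin n), C.card ≤ (k + 1) * r →
    ε ^ k ≤ ∑ a : Fin k → (Fin n → Bool),
      if UsefulSet P ε r b (C.filter fun i => ∀ j, a j i = b i) then ∏ j, P (a j) else 0 := by
  induction k with
  | zero =>
    intro C hC
    have : ∀ D ⊆ C, UsefulSet P ε r b D := by
      intro D hD
      refine UsefulSet.mono hP0 ?_ hD
      unfold UsefulSet
      have : ∀ x : Fin n → Bool, (C.filter fun i => x i ≠ b i).card ≤ r := fun x =>
        (Finset.card_filter_le _ _).trans (by simpa using hC)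
      simp only [this, if_true, hP1]
      linarith
    simp only [this _ (Finset.filter_subset _ _), if_true, sum_prod_one P hP1, pow_zero, le_refl]
  | succ k ih =>
    intro C hC
    by_cases hg : UsefulSet P ε r b C
    · simp only [hg.mono hP0 (Finset.filter_subset _ _), if_true, sum_prod_one P hP1]
      exact pow_le_one₀ hε0.le hε1.le
    · rw [sum_cons]
      have key : ∀ x : Fin n → Bool,
          (P x - if (C.filter fun i => x i ≠ b i).card ≤ r then P x else 0) * ε ^ k ≤
          ∑ a : Fin k → (Fin n → Bool),
            if UsefulSet P ε r b (C.filter fun i =>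
              ∀ j, (Fin.cons x a : Fin (k+1) → (Fin n → Bool)) j i = b i)
            then ∏ j, P ((Fin.cons x a : Fin (k+1) → (Fin n → Bool)) j) else 0 := by
        intro x
        by_cases hx : (C.filter fun i => x i ≠ b i).card ≤ r
        · rw [if_pos hx, sub_self, zero_mul]
          refine Finset.sum_nonneg fun a _ => ?_
          split_ifs
          · exact Finset.prod_nonneg fun j _ => hP0 _
          · exact le_rfl
        · rw [if_neg hx, sub_zero]
          have h1 := Finset.card_filter_add_card_filter_not (s := C) (fun i => x i = b i)
          have h2 := ih (C.filter fun i => x i = b i) (by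
            have : (k + 1 + 1) * r = (k + 1) * r + r := by ring
            simp only [ne_eq] at hx
            omega)
          refine (mul_le_mul_of_nonneg_left h2 (hP0 x)).trans (le_of_eq ?_)
          rw [Finset.mul_sum]
          refine Finset.sum_congr rfl fun a _ => ?_
          rw [mul_ite, mul_zero, Finset.filter_filter]
          simp only [Fin.forall_fin_succ (n := k), Fin.cons_zero, Fin.cons_succ, Fin.prod_univ_succ]
      refine le_trans ?_ (Finset.sum_le_sum fun x _ => key x)
      rw [← Finset.sum_mul, Finset.sum_sub_distrib, hP1, pow_succ, mul_comm]
      unfold UsefulSet at hg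
      refine mul_le_mul_of_nonneg_right ?_ (by positivity)
      linarith

open scoped Classical in
/-- Let `n, r ≥ 1`, let `P` be a probability distribution on `{−1,1}^n`
(points encoded as `Fin n → Bool`), let `ε ∈ (0,1)`, and let `m = ⌈n/r⌉`.  Draw
`a¹, …, a^m` i.i.d. from `P` and let `Const(ā) = {i : a¹_i = ⋯ = a^m_i}`.  Then with
probability at least `ε^m` over the draw, `Pr_{x∼P}[ |{i ∈ Const(ā) : x_i ≠ a¹_i}| ≤ r ]
≥ 1 − ε`. -/
theorem useful_tuple_probability (n r : ℕ) (hn : 1 ≤ n) (hr : 1 ≤ r)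
    (P : (Fin n → Bool) → ℝ) (hP0 : ∀ x, 0 ≤ P x) (hP1 : ∑ x : Fin n → Bool, P x = 1)
    (ε : ℝ) (hε0 : 0 < ε) (hε1 : ε < 1)
    (m : ℕ) (hm : m = ⌈(n : ℝ) / (r : ℝ)⌉₊) :
    have hm0 : 0 < m := by
      rw [hm]
      exact Nat.ceil_pos.mpr (div_pos (by exact_mod_cast hn) (by exact_mod_cast hr))
    ε ^ m ≤ ∑ a : Fin m → (Fin n → Bool),
      if 1 - ε ≤ ∑ x : Fin n → Bool,
          (if (Finset.univ.filter fun i : Fin n =>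
                (∀ j : Fin m, a j i = a ⟨0, hm0⟩ i) ∧ x i ≠ a ⟨0, hm0⟩ i).card ≤ r
            then P x else 0)
        then ∏ j : Fin m, P (a j) else 0 := by
  intro hm0
  have hnm : n ≤ m * r := by
    have h := Nat.le_ceil ((n : ℝ) / (r : ℝ))
    rw [← hm, div_le_iff₀ (by exact_mod_cast hr)] at h
    exact_mod_cast h
  clear_value hm0
  clear hm
  obtain ⟨k, rfl⟩ : ∃ k, m = k + 1 := ⟨m - 1, by omega⟩
  rw [sum_cons]
  have key : ∀ b : Fin n → Bool, P b * ε ^ k ≤ ∑ a : Fin k → (Fin n → Bool), _ := fun b => by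
    refine (mul_le_mul_of_nonneg_left (useful_step (r := r) P hP0 hP1 ε hε0 hε1 b k Finset.univ
      (by simpa using hnm)) (hP0 b)).trans (le_of_eq ?_)
    rw [Finset.mul_sum]
  refine le_trans ?_ (Finset.sum_le_sum fun b _ => (key b).trans (le_of_eq ?_))
  · rw [← Finset.sum_mul, hP1, one_mul]
    exact pow_le_pow_of_le_one hε0.le hε1.le (Nat.le_succ k)
  · refine Finset.sum_congr rfl fun a _ => ?_
    have h0 : (⟨0, hm0⟩ : Fin (k+1)) = 0 := rfl
    simp only [h0, mul_ite, mul_zero, UsefulSet, Finset.filter_filter,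
      Fin.forall_fin_succ (n := k), Fin.cons_zero, Fin.cons_succ, Fin.prod_univ_succ, true_and]
end

section
/- Let k ≥ 1 and t ≥ 1 be integers, let U be a finite set with |U| = k, let μ be a probability distribution on the subsets of U, let δ ∈ (0,1), and let m = ⌈k/t⌉. Draw A₁, …, A_m independently from μ and set C = A₁ ∪ ⋯ ∪ A_m. Then with probability at least δ^m over the draw, Pr_{R∼μ}[ |R \ C| ≥ t ] ≤ δ. -/
open scoped Classical in
/-- Probability that a set drawn from `μ` has at least `t` elements outside `C`. -/
noncomputable def badProb {U : Type*} [Fintype U] [DecidableEq U] (t : ℕ)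
    (μ : Finset U → ℝ) (C : Finset U) : ℝ :=
  ∑ R : Finset U, if t ≤ (R \ C).card then μ R else 0

theorem badProb_anti {U : Type*} [Fintype U] [DecidableEq U] (t : ℕ)
    (μ : Finset U → ℝ) (hμ0 : ∀ S, 0 ≤ μ S) {C D : Finset U} (h : C ⊆ D) :
    badProb t μ D ≤ badProb t μ C := by
  unfold badProb
  refine Finset.sum_le_sum fun R _ => ?_
  have h1 : (R \ D).card ≤ (R \ C).card :=
    Finset.card_le_card (Finset.sdiff_subset_sdiff le_rfl h)
  have := hμ0 R
  split_ifs <;> linarith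

theorem sum_prod_one_s5 {U : Type*} [Fintype U] [DecidableEq U]
    (μ : Finset U → ℝ) (hμ1 : ∑ S : Finset U, μ S = 1) (n : ℕ) :
    ∑ A : Fin n → Finset U, ∏ j, μ (A j) = 1 := by
  have := Finset.prod_univ_sum (fun _ : Fin n => (Finset.univ : Finset (Finset U)))
    (fun _ S => μ S)
  rw [Fintype.piFinset_univ] at this
  rw [← this]
  simp [hμ1]

open scoped Classical in
theorem cover_aux {U : Type*} [Fintype U] [DecidableEq U] (t : ℕ) (ht : 1 ≤ t)
    (μ : Finset U → ℝ) (hμ0 : ∀ S, 0 ≤ μ S) (hμ1 : ∑ S : Finset U, μ S = 1)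
    (δ : ℝ) (hδ0 : 0 < δ) (hδ1 : δ < 1) (n : ℕ) :
    ∀ B : Finset U, Bᶜ.card ≤ n * t →
    δ ^ n ≤ ∑ A : Fin n → Finset U,
      if badProb t μ (B ∪ Finset.univ.sup A) ≤ δ then ∏ j, μ (A j) else 0 := by
  induction n with
  | zero =>
    intro B hB
    have hB' : B = Finset.univ := by simpa using hB
    have : badProb t μ Finset.univ = 0 := by
      unfold badProb
      refine Finset.sum_eq_zero fun R _ => ?_
      rw [if_neg]
      have h0 : R \ Finset.univ = ∅ := Finset.sdiff_eq_empty_iff_subset.mpr (Finset.subset_univ R)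
      rw [h0, Finset.card_empty]
      omega
    simp [hB', this, hδ0.le]
  | succ n ih =>
    intro B hB
    by_cases hb : badProb t μ B ≤ δ
    · have : ∀ A : Fin (n+1) → Finset U, badProb t μ (B ∪ Finset.univ.sup A) ≤ δ :=
        fun A => (badProb_anti t μ hμ0 Finset.subset_union_left).trans hb
      simp only [this, if_true]
      rw [sum_prod_one_s5 μ hμ1]
      exact pow_le_one₀ hδ0.le hδ1.le
    · push Not at hb
      rw [← (Fin.consEquiv fun _ : Fin (n+1) => Finset U).sum_comp, Fintype.sum_prod_type]
      calc δ ^ (n+1) = δ * δ ^ n := by ring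
        _ ≤ badProb t μ B * δ ^ n := by gcongr
        _ = ∑ R : Finset U, (if t ≤ (R \ B).card then μ R else 0) * δ ^ n := by
          unfold badProb; rw [Finset.sum_mul]
        _ ≤ _ := by
          refine Finset.sum_le_sum fun R _ => ?_
          split_ifs with hR
          · have hc : (B ∪ R)ᶜ.card ≤ n * t := by
              have h1 : (B ∪ R).card = B.card + (R \ B).card := by
                rw [← Finset.union_sdiff_self_eq_union,
                  Finset.card_union_of_disjoint Finset.disjoint_sdiff]
              have h2 := Finset.card_add_card_compl B
              have h3 := Finset.card_add_card_compl (B ∪ R)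
              rw [Nat.succ_mul] at hB
              omega
            calc μ R * δ ^ n ≤ μ R * _ := mul_le_mul_of_nonneg_left (ih (B ∪ R) hc) (hμ0 R)
              _ = _ := by
                rw [Finset.mul_sum]
                refine Finset.sum_congr rfl fun A _ => ?_
                have hs : Finset.univ.sup ((Fin.consEquiv fun _ : Fin (n+1) => Finset U) (R, A))
                    = R ∪ Finset.univ.sup A := by
                  rw [Fin.univ_succ, Finset.sup_cons, Finset.sup_map]
                  rfl
                rw [hs]
                simp only [Fin.consEquiv_apply, Fin.prod_univ_succ, Fin.cons_zero,
                  Fin.cons_succ, Finset.union_assoc, mul_ite, mul_zero]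
          · rw [zero_mul]
            refine Finset.sum_nonneg fun A _ => ?_
            split_ifs
            · exact Finset.prod_nonneg fun j _ => hμ0 _
            · exact le_rfl


open scoped Classical in
/-- Let `k, t ≥ 1`, let `U` be a finite set with `|U| = k`, let `μ` be a
probability distribution on the subsets of `U`, let `δ ∈ (0,1)`, and let `m = ⌈k/t⌉`.
Draw `A₁, …, A_m` i.i.d. from `μ` and set `C = A₁ ∪ ⋯ ∪ A_m`.  Then with probability at
least `δ^m` over the draw, `Pr_{R∼μ}[ |R \ C| ≥ t ] ≤ δ`. -/
theorem spectral_cover_probability (U : Type*) [Fintype U] [DecidableEq U]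
    (k t : ℕ) (hk : 1 ≤ k) (ht : 1 ≤ t) (hU : Fintype.card U = k)
    (μ : Finset U → ℝ) (hμ0 : ∀ S, 0 ≤ μ S) (hμ1 : ∑ S : Finset U, μ S = 1)
    (δ : ℝ) (hδ0 : 0 < δ) (hδ1 : δ < 1)
    (m : ℕ) (hm : m = ⌈(k : ℝ) / (t : ℝ)⌉₊) :
    δ ^ m ≤ ∑ A : Fin m → Finset U,
      if (∑ R : Finset U, if t ≤ (R \ Finset.univ.sup A).card then μ R else 0) ≤ δ
        then ∏ j : Fin m, μ (A j) else 0 := by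


  have hc : (∅ : Finset U)ᶜ.card ≤ m * t := by
    have ht' : (0 : ℝ) < t := by exact_mod_cast ht
    have h := Nat.le_ceil ((k : ℝ) / (t : ℝ))
    rw [← hm, div_le_iff₀ ht'] at h
    rw [Finset.compl_empty, Finset.card_univ, hU]
    exact_mod_cast h
  have h := cover_aux t ht μ hμ0 hμ1 δ hδ0 hδ1 m ∅ hc
  simp only [Finset.empty_union] at h
  exact h
end

section
/- Let f : {−1,1}^n → ℝ, let r ≥ 1 be an integer, let α₁, …, α_r be real numbers, and define the univariate polynomial p(t) = Σ_{i=1}^r α_i·binom(t,i), where binom(t,i) := t(t−1)⋯(t−i+1)/i! (so p(0) = 0). Then for every x ∈ {−1,1}^n: f(x) − Σ_{i=1}^r α_i · Σ_{S ⊆ [n], |S| = i} 2^{−i} Σ_{T ⊆ S} (−1)^{|T|} f(x^{⊕T}) = f̂(∅) + Σ_{∅ ≠ U ⊆ [n]} (1 − p(|U|)) f̂(U) χ_U(x), where x^{⊕T} denotes x with the coordinates in T flipped. -/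
/-- The sign `±1 ∈ ℝ` associated to a Boolean coordinate value. -/
noncomputable def sgnB (b : Bool) : ℝ := if b then 1 else -1

/-- The Fourier character `χ_S(x) = ∏_{i ∈ S} x_i` on the Boolean cube `{−1,1}^n`,
with points encoded as `Fin n → Bool`. -/
noncomputable def chi {n : ℕ} (S : Finset (Fin n)) (x : Fin n → Bool) : ℝ :=
  ∏ i ∈ S, sgnB (x i)

/-- Expectation over a uniformly random point of the Boolean cube `{−1,1}^n`. -/
noncomputable def expectCube {n : ℕ} (f : (Fin n → Bool) → ℝ) : ℝ :=
  (∑ x : Fin n → Bool, f x) / 2 ^ n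

/-- The Fourier coefficient `f̂(S) = E_x[f(x)·χ_S(x)]`. -/
noncomputable def fhat {n : ℕ} (f : (Fin n → Bool) → ℝ) (S : Finset (Fin n)) : ℝ :=
  expectCube (fun x => f x * chi S x)

/-- `x^{⊕T}`: the point `x` with the coordinates in `T` flipped. -/
def flipOn {n : ℕ} (x : Fin n → Bool) (T : Finset (Fin n)) : Fin n → Bool :=
  fun i => if i ∈ T then !(x i) else x i

lemma sgnB_mul_self' (b : Bool) : sgnB b * sgnB b = 1 := by
  cases b <;> simp [sgnB]

lemma sum_chi_mul_chi {n : ℕ} (x y : Fin n → Bool) :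
    ∑ U : Finset (Fin n), chi U y * chi U x = if y = x then (2 : ℝ) ^ n else 0 := by
  have h : ∑ U : Finset (Fin n), chi U y * chi U x
      = ∏ i : Fin n, (1 + sgnB (y i) * sgnB (x i)) := by
    rw [Finset.prod_one_add, Finset.powerset_univ]
    refine Finset.sum_congr rfl fun U _ => ?_
    simp [chi, Finset.prod_mul_distrib]
  rw [h]
  split_ifs with hxy
  · subst hxy
    simp only [sgnB_mul_self']
    norm_num
  · obtain ⟨i, hi⟩ := Function.ne_iff.mp hxy
    refine Finset.prod_eq_zero (Finset.mem_univ i) ?_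
    revert hi
    cases y i <;> cases x i <;> simp [sgnB]

lemma fourier_inversion {n : ℕ} (f : (Fin n → Bool) → ℝ) (x : Fin n → Bool) :
    f x = ∑ U : Finset (Fin n), fhat f U * chi U x := by
  have h : ∑ U : Finset (Fin n), fhat f U * chi U x
      = (∑ y : Fin n → Bool, f y * ∑ U : Finset (Fin n), chi U y * chi U x) / 2 ^ n := by
    simp only [fhat, expectCube, Finset.mul_sum, Finset.sum_div, Finset.sum_mul]
    rw [Finset.sum_comm]
    refine Finset.sum_congr rfl fun y _ => Finset.sum_congr rfl fun U _ => ?_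
    ring
  rw [h]
  simp only [sum_chi_mul_chi]
  simp

lemma chi_flipOn {n : ℕ} (U T : Finset (Fin n)) (x : Fin n → Bool) :
    chi U (flipOn x T) = chi U x * ∏ i ∈ T, (if i ∈ U then (-1 : ℝ) else 1) := by
  have h : ∏ i ∈ T, (if i ∈ U then (-1 : ℝ) else 1) = ∏ i ∈ U, (if i ∈ T then (-1 : ℝ) else 1) := by
    rw [← Finset.prod_filter, ← Finset.prod_filter]
    refine Finset.prod_congr ?_ fun _ _ => rfl
    ext i
    simp [and_comm]
  rw [h, chi, chi, ← Finset.prod_mul_distrib]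
  refine Finset.prod_congr rfl fun i _ => ?_
  by_cases hi : i ∈ T <;> cases hx : x i <;> simp [flipOn, hi, hx, sgnB]

lemma sum_flip_chi {n : ℕ} (U S : Finset (Fin n)) (x : Fin n → Bool) :
    ∑ T ∈ S.powerset, (-1 : ℝ) ^ T.card * chi U (flipOn x T)
      = chi U x * if S ⊆ U then (2 : ℝ) ^ S.card else 0 := by
  have h : (if S ⊆ U then (2 : ℝ) ^ S.card else 0)
      = ∏ i ∈ S, (1 + if i ∈ U then (1 : ℝ) else -1) := by
    split_ifs with hS
    · rw [Finset.prod_congr rfl (g := fun _ => (2 : ℝ))]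
      · simp
      · intro i hi
        simp only [hS hi, if_true]
        norm_num
    · obtain ⟨i, hi, hiU⟩ := Finset.not_subset.mp hS
      exact (Finset.prod_eq_zero hi (by simp [hiU])).symm
  rw [h, Finset.prod_one_add, Finset.mul_sum]
  refine Finset.sum_congr rfl fun T _ => ?_
  rw [chi_flipOn, mul_left_comm, ← Finset.prod_const, ← Finset.prod_mul_distrib]
  congr 1
  refine Finset.prod_congr rfl fun i _ => ?_
  split_ifs <;> simp

lemma choose_eq_prod (m i : ℕ) :
    ((∏ j ∈ Finset.range i, ((m : ℝ) - (j : ℝ))) / (Nat.factorial i)) = (m.choose i : ℝ) := by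
  rw [← descPochhammer_eval_eq_prod_range, descPochhammer_eval_eq_descFactorial,
    Nat.descFactorial_eq_factorial_mul_choose]
  have := Nat.factorial_ne_zero i
  push_cast
  field_simp

lemma level_sum {n : ℕ} (f : (Fin n → Bool) → ℝ) (x : Fin n → Bool) (i : ℕ) :
    ∑ S ∈ Finset.univ.filter (fun S : Finset (Fin n) => S.card = i),
        (2 : ℝ)⁻¹ ^ i * ∑ T ∈ S.powerset, (-1 : ℝ) ^ T.card * f (flipOn x T)
      = ∑ U : Finset (Fin n), (U.card.choose i : ℝ) * (fhat f U * chi U x) := by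
  have h1 : ∀ S ∈ Finset.univ.filter (fun S : Finset (Fin n) => S.card = i),
      (2 : ℝ)⁻¹ ^ i * ∑ T ∈ S.powerset, (-1 : ℝ) ^ T.card * f (flipOn x T)
        = ∑ U : Finset (Fin n), (if S ⊆ U then (1 : ℝ) else 0) * (fhat f U * chi U x) := by
    intro S hS
    have hc : S.card = i := by simpa using hS
    have h2 : ∑ T ∈ S.powerset, (-1 : ℝ) ^ T.card * f (flipOn x T)
        = ∑ U : Finset (Fin n), fhat f U *
          ∑ T ∈ S.powerset, (-1 : ℝ) ^ T.card * chi U (flipOn x T) := by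
      simp only [Finset.mul_sum]
      rw [Finset.sum_comm]
      refine Finset.sum_congr rfl fun T _ => ?_
      rw [fourier_inversion f (flipOn x T), Finset.mul_sum]
      refine Finset.sum_congr rfl fun U _ => ?_
      ring
    rw [h2, Finset.mul_sum]
    refine Finset.sum_congr rfl fun U _ => ?_
    rw [sum_flip_chi, hc]
    split_ifs
    · rw [inv_pow]
      field_simp
    · simp
  rw [Finset.sum_congr rfl h1, Finset.sum_comm]
  refine Finset.sum_congr rfl fun U _ => ?_
  rw [← Finset.sum_mul]
  congr 1
  rw [← Finset.sum_filter, Finset.sum_const, nsmul_eq_mul, mul_one, ← Finset.card_powersetCard]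
  congr 2
  ext S
  simp [Finset.mem_powersetCard, and_comm]

/-- Let `f : {−1,1}^n → ℝ`, `r ≥ 1`, `α₁, …, α_r ∈ ℝ`, and let
`p(t) = Σ_{i=1}^r α_i·binom(t,i)` where `binom(t,i) = t(t−1)⋯(t−i+1)/i!` (so `p(0) = 0`).
Then for every `x ∈ {−1,1}^n`:
`f(x) − Σ_{i=1}^r α_i Σ_{|S|=i} 2^{−i} Σ_{T⊆S} (−1)^{|T|} f(x^{⊕T})
  = f̂(∅) + Σ_{∅≠U⊆[n]} (1 − p(|U|)) f̂(U) χ_U(x)`. -/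
theorem local_estimator_fourier_identity (n r : ℕ) (hr : 1 ≤ r)
    (f : (Fin n → Bool) → ℝ) (α : ℕ → ℝ) (p : ℝ → ℝ)
    (hp : ∀ t : ℝ, p t =
      ∑ i ∈ Finset.Icc 1 r, α i * ((∏ j ∈ Finset.range i, (t - (j : ℝ))) / (Nat.factorial i))) :
    ∀ x : Fin n → Bool,
      f x - ∑ i ∈ Finset.Icc 1 r, α i *
          ∑ S ∈ Finset.univ.filter (fun S : Finset (Fin n) => S.card = i),
            (2 : ℝ)⁻¹ ^ i * ∑ T ∈ S.powerset, (-1 : ℝ) ^ T.card * f (flipOn x T)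
        = fhat f ∅ + ∑ U ∈ Finset.univ.filter (fun U : Finset (Fin n) => U ≠ ∅),
            (1 - p (U.card : ℝ)) * fhat f U * chi U x := by
  intro x
  have hL : f x - ∑ i ∈ Finset.Icc 1 r, α i *
          ∑ S ∈ Finset.univ.filter (fun S : Finset (Fin n) => S.card = i),
            (2 : ℝ)⁻¹ ^ i * ∑ T ∈ S.powerset, (-1 : ℝ) ^ T.card * f (flipOn x T)
      = ∑ U : Finset (Fin n), (1 - p (U.card : ℝ)) * fhat f U * chi U x := by
    have hP : ∑ i ∈ Finset.Icc 1 r, α i *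
          ∑ U : Finset (Fin n), (U.card.choose i : ℝ) * (fhat f U * chi U x)
        = ∑ U : Finset (Fin n), p (U.card : ℝ) * (fhat f U * chi U x) := by
      simp only [hp, choose_eq_prod, Finset.mul_sum, Finset.sum_mul]
      rw [Finset.sum_comm]
      refine Finset.sum_congr rfl fun U _ => Finset.sum_congr rfl fun i _ => ?_
      ring
    simp only [level_sum]
    rw [hP, fourier_inversion f x, ← Finset.sum_sub_distrib]
    refine Finset.sum_congr rfl fun U _ => ?_
    ring
  have hp0 : p 0 = 0 := by
    rw [hp]
    refine Finset.sum_eq_zero fun i hi => ?_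
    have hi1 : 1 ≤ i := (Finset.mem_Icc.mp hi).1
    rw [Finset.prod_eq_zero (Finset.mem_range.mpr hi1) (by simp)]
    simp
  rw [hL, Finset.filter_ne', ← Finset.add_sum_erase _ _ (Finset.mem_univ (∅ : Finset (Fin n)))]
  simp [hp0, chi]
end

section
/- Let f : {−1,1}^n → ℝ, let L be an integer with 1 ≤ L ≤ n, let τ, M ≥ 0, and let p : ℝ → ℝ be any function with p(0) = 0 such that |1 − p(i)| ≤ τ for all integers 1 ≤ i ≤ L, and |1 − p(i)| ≤ M for all integers L < i ≤ n. Define g : {−1,1}^n → ℝ by g(x) = f̂(∅) + Σ_{∅ ≠ U ⊆ [n]} (1 − p(|U|)) f̂(U) χ_U(x). Then | E_x[|g(x)|] − |E_x[f(x)]| | ≤ √( τ²·Var[f] + M²·W^{≥L}[f] ) ≤ τ·√Var[f] + M·√(W^{≥L}[f]). -/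
/-- `Var[f] = Σ_{S ≠ ∅} f̂(S)²`. -/
noncomputable def fourierVar {n : ℕ} (f : (Fin n → Bool) → ℝ) : ℝ :=
  ∑ S ∈ Finset.univ.filter (fun S : Finset (Fin n) => S ≠ ∅), (fhat f S) ^ 2

/-- `W^{≥L}[f] = Σ_{|S| ≥ L} f̂(S)²`, the Fourier weight at levels `L` and above. -/
noncomputable def weightAbove {n : ℕ} (L : ℕ) (f : (Fin n → Bool) → ℝ) : ℝ :=
  ∑ S ∈ Finset.univ.filter (fun S : Finset (Fin n) => L ≤ S.card), (fhat f S) ^ 2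

theorem sum_chi_mul {n : ℕ} (S T : Finset (Fin n)) :
    ∑ x : Fin n → Bool, chi S x * chi T x = if S = T then (2 : ℝ) ^ n else 0 := by
  have h1 : ∀ x : Fin n → Bool, chi S x * chi T x =
      ∏ i, ((if i ∈ S then sgnB (x i) else 1) * (if i ∈ T then sgnB (x i) else 1)) := by
    intro x
    rw [Finset.prod_mul_distrib]
    simp [chi, Finset.prod_ite_mem]
  simp_rw [h1]
  have h2 := Finset.prod_univ_sum (fun _ : Fin n => (Finset.univ : Finset Bool))
    (fun i b => (if i ∈ S then sgnB b else 1) * (if i ∈ T then sgnB b else (1 : ℝ)))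
  rw [Fintype.piFinset_univ] at h2
  rw [← h2]
  split_ifs with h
  · subst h
    have : ∀ i : Fin n, ∑ b : Bool,
        (if i ∈ S then sgnB b else 1) * (if i ∈ S then sgnB b else (1 : ℝ)) = 2 := by
      intro i
      by_cases hi : i ∈ S <;> simp [hi, sgnB] <;> norm_num
    rw [Finset.prod_congr rfl fun i _ => this i]
    simp
  · obtain ⟨i, hi⟩ : ∃ i, ¬ (i ∈ S ↔ i ∈ T) := by
      by_contra hc
      push Not at hc
      exact h (Finset.ext hc)
    apply Finset.prod_eq_zero (Finset.mem_univ i)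
    by_cases hS : i ∈ S <;> by_cases hT : i ∈ T <;> simp_all [sgnB]

theorem parseval_sum {n : ℕ} (A : Finset (Finset (Fin n))) (c : Finset (Fin n) → ℝ) :
    ∑ x : Fin n → Bool, (∑ U ∈ A, c U * chi U x) ^ 2 = 2 ^ n * ∑ U ∈ A, c U ^ 2 := by
  have h : ∀ x : Fin n → Bool, (∑ U ∈ A, c U * chi U x) ^ 2 =
      ∑ U ∈ A, ∑ V ∈ A, c U * c V * (chi U x * chi V x) := by
    intro x
    rw [sq, Finset.sum_mul_sum]
    refine Finset.sum_congr rfl fun U _ => Finset.sum_congr rfl fun V _ => by ring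
  simp_rw [h]
  rw [Finset.sum_comm, Finset.mul_sum]
  refine Finset.sum_congr rfl fun U hU => ?_
  rw [Finset.sum_comm]
  simp_rw [← Finset.mul_sum, sum_chi_mul]
  simp [hU]
  ring

/-- Let `f : {−1,1}^n → ℝ`, `1 ≤ L ≤ n`, `τ, M ≥ 0`, and let `p : ℝ → ℝ`
satisfy `p(0) = 0`, `|1 − p(i)| ≤ τ` for integers `1 ≤ i ≤ L`, and `|1 − p(i)| ≤ M` for
integers `L < i ≤ n`.  Define `g(x) = f̂(∅) + Σ_{∅≠U} (1 − p(|U|)) f̂(U) χ_U(x)`.  Then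
`| E|g| − |E f| | ≤ √(τ²·Var[f] + M²·W^{≥L}[f]) ≤ τ·√Var[f] + M·√(W^{≥L}[f])`. -/
theorem smooth_local_mean_estimator (n L : ℕ) (hL1 : 1 ≤ L) (hLn : L ≤ n)
    (f : (Fin n → Bool) → ℝ) (τ M : ℝ) (hτ : 0 ≤ τ) (hM : 0 ≤ M)
    (p : ℝ → ℝ) (hp0 : p 0 = 0)
    (hplow : ∀ i : ℕ, 1 ≤ i → i ≤ L → |1 - p (i : ℝ)| ≤ τ)
    (hphigh : ∀ i : ℕ, L < i → i ≤ n → |1 - p (i : ℝ)| ≤ M)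
    (g : (Fin n → Bool) → ℝ)
    (hg : ∀ x, g x = fhat f ∅ +
      ∑ U ∈ Finset.univ.filter (fun U : Finset (Fin n) => U ≠ ∅),
        (1 - p (U.card : ℝ)) * fhat f U * chi U x) :
    abs (expectCube (fun x => |g x|) - |expectCube f|) ≤
        Real.sqrt (τ ^ 2 * fourierVar f + M ^ 2 * weightAbove L f) ∧
      Real.sqrt (τ ^ 2 * fourierVar f + M ^ 2 * weightAbove L f) ≤
        τ * Real.sqrt (fourierVar f) + M * Real.sqrt (weightAbove L f) := by
  have hV : 0 ≤ fourierVar f := Finset.sum_nonneg fun _ _ => sq_nonneg _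
  have hW : 0 ≤ weightAbove L f := Finset.sum_nonneg fun _ _ => sq_nonneg _
  constructor
  · have ha : fhat f ∅ = expectCube f := by simp [fhat, chi]
    have h2n : (0 : ℝ) < 2 ^ n := by positivity
    set A := Finset.univ.filter (fun U : Finset (Fin n) => U ≠ ∅) with hA
    set h : (Fin n → Bool) → ℝ := fun x =>
      ∑ U ∈ A, (1 - p (U.card : ℝ)) * fhat f U * chi U x with hh
    have hpars := parseval_sum A (fun U => (1 - p (U.card : ℝ)) * fhat f U)
    have hbound : ∑ U ∈ A, ((1 - p (U.card : ℝ)) * fhat f U) ^ 2 ≤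
        τ ^ 2 * fourierVar f + M ^ 2 * weightAbove L f := by
      have hw : weightAbove L f = ∑ U ∈ A, if L ≤ U.card then (fhat f U) ^ 2 else 0 := by
        rw [weightAbove, ← Finset.sum_filter]
        refine Finset.sum_congr ?_ fun _ _ => rfl
        ext U
        simp only [hA, Finset.mem_filter, Finset.mem_univ, true_and]
        constructor
        · intro hU
          refine ⟨?_, hU⟩
          rintro rfl
          simp at hU
          omega
        · exact fun hU => hU.2
      rw [hw, fourierVar, Finset.mul_sum, Finset.mul_sum, ← Finset.sum_add_distrib]
      refine Finset.sum_le_sum fun U hU => ?_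
      have hne : U ≠ ∅ := by simpa [hA] using hU
      have hpos : 1 ≤ U.card := Finset.card_pos.mpr (Finset.nonempty_iff_ne_empty.mpr hne)
      have hcn : U.card ≤ n := by simpa using Finset.card_le_univ U
      rw [mul_pow]
      rcases le_or_gt U.card L with hc | hc
      · have h1 := hplow _ hpos hc
        have h2 : (1 - p (U.card : ℝ)) ^ 2 ≤ τ ^ 2 := sq_le_sq' (abs_le.mp h1).1 (abs_le.mp h1).2
        have h3 : 0 ≤ M ^ 2 * (if L ≤ U.card then (fhat f U) ^ 2 else 0) := by
          split_ifs <;> positivity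
        have h4 := mul_le_mul_of_nonneg_right h2 (sq_nonneg (fhat f U))
        linarith
      · have h1 := hphigh _ hc hcn
        have h2 : (1 - p (U.card : ℝ)) ^ 2 ≤ M ^ 2 := sq_le_sq' (abs_le.mp h1).1 (abs_le.mp h1).2
        rw [if_pos hc.le]
        have h4 := mul_le_mul_of_nonneg_right h2 (sq_nonneg (fhat f U))
        have h3 : 0 ≤ τ ^ 2 * fhat f U ^ 2 := by positivity
        linarith
    have hconst : |expectCube f| = (∑ x : Fin n → Bool, |expectCube f|) / 2 ^ n := by
      simp
    have hstep : abs (expectCube (fun x => |g x|) - |expectCube f|) ≤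
        (∑ x : Fin n → Bool, |h x|) / 2 ^ n := by
      rw [hconst]
      unfold expectCube
      rw [← sub_div, ← Finset.sum_sub_distrib, abs_div, abs_of_pos h2n]
      refine div_le_div_of_nonneg_right ?_ h2n.le
      refine (Finset.abs_sum_le_sum_abs _ _).trans (Finset.sum_le_sum fun x _ => ?_)
      refine (abs_abs_sub_abs_le_abs_sub _ _).trans (le_of_eq ?_)
      congr 1
      rw [hg x, ha]
      simp only [expectCube, hh]
      ring
    refine hstep.trans (Real.le_sqrt_of_sq_le (le_trans ?_ hbound))
    have hcs := sq_sum_le_card_mul_sum_sq (s := (Finset.univ : Finset (Fin n → Bool)))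
      (f := fun x => |h x|)
    simp only [sq_abs] at hcs
    have hcard : ((Finset.univ : Finset (Fin n → Bool)).card : ℝ) = 2 ^ n := by simp
    rw [hcard] at hcs
    rw [div_pow, div_le_iff₀ (by positivity)]
    refine hcs.trans (le_of_eq ?_)
    simp only [hh]
    rw [hpars]
    ring
  · rw [Real.sqrt_le_left (by positivity)]
    have h1 := Real.sq_sqrt hV
    have h2 := Real.sq_sqrt hW
    have h3 : 0 ≤ τ * √(fourierVar f) * (M * √(weightAbove L f)) := by positivity
    calc _ = τ ^ 2 * √(fourierVar f) ^ 2 + M ^ 2 * √(weightAbove L f) ^ 2 := by rw [h1, h2]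
      _ ≤ _ := by nlinarith
end

section
/- Let ℓ ≥ 1, κ ≥ 5, and Δ ≥ 1 be integers, let ρ = 1 − 1/(2ℓ), and define λ : ℕ → ℝ by λ(m) = (1 − (1 − ρ^m)^κ)^Δ. Then for every m ∈ ℕ we have 0 ≤ λ(m) ≤ 1; if m ≤ ℓ then λ(m) ≥ 1 − Δ·2^{−κ}; and if m ≥ κ·ℓ then λ(m) ≤ 2^{−Δ}. -/
/-- Geometric decay beats linear growth from `5` on. -/
lemma aux_decay (κ : ℕ) (hκ : 5 ≤ κ) : (κ : ℝ) * (0.62 : ℝ) ^ κ ≤ 1 / 2 := by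
  induction κ, hκ using Nat.le_induction with
  | base => norm_num
  | succ n hn ih =>
    have h5 : (5 : ℝ) ≤ n := by exact_mod_cast hn
    have hp : (0 : ℝ) < (0.62 : ℝ) ^ n := by positivity
    rw [pow_succ]
    push_cast
    nlinarith [mul_le_mul_of_nonneg_right h5 hp.le]

lemma aux_exp : Real.exp (-(1 / 2)) ≤ 0.62 := by
  have h : Real.exp (-(1 / 2)) ^ 2 = Real.exp (-1) := by
    rw [← Real.exp_nat_mul]; norm_num
  have h1 := Real.exp_neg_one_lt_d9
  exact le_of_not_gt fun hc => by nlinarith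

/-- Let `ℓ ≥ 1`, `κ ≥ 5`, `Δ ≥ 1` be integers, `ρ = 1 − 1/(2ℓ)`, and
`λ(m) = (1 − (1 − ρ^m)^κ)^Δ` (the Fourier multiplier of the SharpNoise operator).  Then
for every `m ∈ ℕ`: `0 ≤ λ(m) ≤ 1`; if `m ≤ ℓ` then `λ(m) ≥ 1 − Δ·2^{−κ}`; and if
`m ≥ κ·ℓ` then `λ(m) ≤ 2^{−Δ}`. -/
theorem sharpnoise_multiplier_bounds (ℓ κ Δ : ℕ) (hℓ : 1 ≤ ℓ) (hκ : 5 ≤ κ) (hΔ : 1 ≤ Δ)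
    (ρ : ℝ) (hρ : ρ = 1 - 1 / (2 * (ℓ : ℝ)))
    (lam : ℕ → ℝ) (hlam : ∀ m : ℕ, lam m = (1 - (1 - ρ ^ m) ^ κ) ^ Δ) :
    (∀ m : ℕ, 0 ≤ lam m ∧ lam m ≤ 1) ∧
      (∀ m : ℕ, m ≤ ℓ → 1 - (Δ : ℝ) * (2 : ℝ) ^ (-(κ : ℤ)) ≤ lam m) ∧
      (∀ m : ℕ, κ * ℓ ≤ m → lam m ≤ (2 : ℝ) ^ (-(Δ : ℤ))) := by
  have hl : (1 : ℝ) ≤ ℓ := by exact_mod_cast hℓ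
  have hinv : 1 / (2 * (ℓ : ℝ)) ≤ 1 / 2 := by
    apply one_div_le_one_div_of_le <;> linarith
  have hinv0 : 0 < 1 / (2 * (ℓ : ℝ)) := by positivity
  have hρ0 : 0 ≤ ρ := by linarith
  have hρ1 : ρ ≤ 1 := by linarith
  have hp0 : ∀ m : ℕ, 0 ≤ ρ ^ m := fun m => pow_nonneg hρ0 m
  have hp1 : ∀ m : ℕ, ρ ^ m ≤ 1 := fun m => pow_le_one₀ hρ0 hρ1
  have hx0 : ∀ m : ℕ, 0 ≤ (1 - ρ ^ m) ^ κ := fun m => pow_nonneg (by linarith [hp1 m]) κ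
  have hx1 : ∀ m : ℕ, (1 - ρ ^ m) ^ κ ≤ 1 := fun m =>
    pow_le_one₀ (by linarith [hp1 m]) (by linarith [hp0 m])
  refine ⟨fun m => ?_, fun m hm => ?_, fun m hm => ?_⟩
  · rw [hlam]
    exact ⟨pow_nonneg (by linarith [hx1 m]) _,
      pow_le_one₀ (by linarith [hx1 m]) (by linarith [hx0 m])⟩
  · rw [hlam]
    have hb : 1 + (m : ℝ) * (ρ - 1) ≤ ρ ^ m := by
      have := one_add_mul_le_pow (a := ρ - 1) (by linarith) m
      simpa using this
    have hm' : (m : ℝ) ≤ ℓ := by exact_mod_cast hm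
    have hmul : (ℓ : ℝ) * (1 / (2 * (ℓ : ℝ))) = 1 / 2 := by field_simp
    have hhalf : 1 - ρ ^ m ≤ 1 / 2 := by
      have : (m : ℝ) * (1 / (2 * (ℓ : ℝ))) ≤ 1 / 2 := by
        rw [← hmul]; exact mul_le_mul_of_nonneg_right hm' hinv0.le
      have h2 : ρ - 1 = -(1 / (2 * (ℓ : ℝ))) := by linarith
      rw [h2] at hb
      linarith
    have hx : (1 - ρ ^ m) ^ κ ≤ (2 : ℝ) ^ (-(κ : ℤ)) := by
      have := pow_le_pow_left₀ (by linarith [hp1 m]) hhalf κ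
      rw [zpow_neg, zpow_natCast, ← inv_pow]
      simpa using this
    have hB := one_add_mul_le_pow (a := -(1 - ρ ^ m) ^ κ) (by linarith [hx1 m]) Δ
    rw [← sub_eq_add_neg] at hB
    have := mul_le_mul_of_nonneg_left hx (Nat.cast_nonneg (α := ℝ) Δ)
    linarith
  · rw [hlam, zpow_neg, zpow_natCast, ← inv_pow]
    apply pow_le_pow_left₀ (by linarith [hx1 m])
    have hρe : ρ ^ ℓ ≤ 0.62 := by
      refine le_trans ?_ aux_exp
      have h1 : ρ ≤ Real.exp (-(1 / (2 * (ℓ : ℝ)))) := by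
        have := Real.add_one_le_exp (-(1 / (2 * (ℓ : ℝ))))
        linarith
      refine (pow_le_pow_left₀ hρ0 h1 ℓ).trans (le_of_eq ?_)
      rw [← Real.exp_nat_mul]
      congr 1
      field_simp
    have hm2 : ρ ^ m ≤ (0.62 : ℝ) ^ κ := by
      calc ρ ^ m ≤ ρ ^ (κ * ℓ) := pow_le_pow_of_le_one hρ0 hρ1 hm
        _ = (ρ ^ ℓ) ^ κ := by rw [mul_comm, pow_mul]
        _ ≤ _ := pow_le_pow_left₀ (hp0 ℓ) hρe κ
    have hB := one_add_mul_le_pow (a := -ρ ^ m) (by linarith [hp1 m]) κ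
    rw [← sub_eq_add_neg] at hB
    have h3 := mul_le_mul_of_nonneg_left hm2 (Nat.cast_nonneg (α := ℝ) κ)
    have h4 := aux_decay κ hκ
    have h5 : (2 : ℝ)⁻¹ = 1 / 2 := by norm_num
    rw [h5]
    linarith
end

section
/- Let f : {−1,1}^n → ℝ with E_x[f(x)²] ≤ 1, let U ⊆ [n], C ⊆ U, let ℓ ≥ 0 be an integer, and let ε ∈ (0,1). Let μ assign to each S ⊆ [n] a value μ(S) ∈ [0,1] such that 1 − μ(S) ≤ ε/√20 whenever |S \ C| ≤ ℓ, and suppose Σ_{R ⊆ U, |R \ C| > ℓ} f̂(R)² ≤ ε²/5. Define g : {−1,1}^n → ℝ by g(x) = Σ_{S⊆[n]} μ(S) f̂(S) χ_S(x). Then | E_x[ |Σ_{R⊆U} f̂(R)χ_R(x)| ] − E_x[ |Σ_{R⊆U} ĝ(R)χ_R(x)| ] | ≤ ε/2. -/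
theorem aux_E_sum {n : ℕ} {ι : Type*} (P : Finset ι) (F : ι → (Fin n → Bool) → ℝ) :
    expectCube (fun x => ∑ i ∈ P, F i x) = ∑ i ∈ P, expectCube (F i) := by
  unfold expectCube
  rw [Finset.sum_comm, Finset.sum_div]

theorem aux_E_mul {n : ℕ} (c : ℝ) (F : (Fin n → Bool) → ℝ) :
    expectCube (fun x => c * F x) = c * expectCube F := by
  unfold expectCube
  rw [← Finset.mul_sum, mul_div_assoc]

theorem aux_E_sub {n : ℕ} (F G : (Fin n → Bool) → ℝ) :
    expectCube (fun x => F x - G x) = expectCube F - expectCube G := by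
  unfold expectCube
  rw [Finset.sum_sub_distrib, sub_div]

theorem aux_E_mono {n : ℕ} (F G : (Fin n → Bool) → ℝ) (h : ∀ x, F x ≤ G x) :
    expectCube F ≤ expectCube G := by
  unfold expectCube
  have := Finset.sum_le_sum (fun x (_ : x ∈ (Finset.univ : Finset (Fin n → Bool))) => h x)
  gcongr

theorem aux_E_const {n : ℕ} (c : ℝ) : expectCube (fun _ : Fin n → Bool => c) = c := by
  unfold expectCube
  simp

theorem aux_orth {n : ℕ} (S T : Finset (Fin n)) :
    expectCube (fun x => chi S x * chi T x) = if S = T then 1 else 0 := by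
  have key : ∑ x : Fin n → Bool, chi S x * chi T x =
      ∏ i : Fin n, ∑ b : Bool, ((if i ∈ S then sgnB b else 1) * (if i ∈ T then sgnB b else 1)) := by
    rw [Finset.prod_univ_sum, Fintype.piFinset_univ]
    refine Finset.sum_congr rfl fun x _ => ?_
    rw [Finset.prod_mul_distrib]
    simp [chi, Finset.prod_ite_mem]
  unfold expectCube
  rw [key]
  split_ifs with h
  · subst h
    have : ∀ i : Fin n, ∑ b : Bool, ((if i ∈ S then sgnB b else 1) * (if i ∈ S then sgnB b else 1)) = 2 := by
      intro i
      by_cases hi : i ∈ S <;> simp [hi, sgnB] <;> norm_num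
    rw [Finset.prod_congr rfl (fun i _ => this i)]
    simp
  · have : ∃ i, ¬ (i ∈ S ↔ i ∈ T) := by
      by_contra hh
      push Not at hh
      exact h (Finset.ext hh)
    obtain ⟨i, hi⟩ := this
    rw [Finset.prod_eq_zero (Finset.mem_univ i), zero_div]
    by_cases h1 : i ∈ S <;> by_cases h2 : i ∈ T <;> simp_all [sgnB]

theorem aux_coef {n : ℕ} (P : Finset (Finset (Fin n))) (a : Finset (Fin n) → ℝ)
    (T : Finset (Fin n)) (hT : T ∈ P) :
    fhat (fun x => ∑ R ∈ P, a R * chi R x) T = a T := by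
  unfold fhat
  have : (fun x : Fin n → Bool => (∑ R ∈ P, a R * chi R x) * chi T x) =
      fun x => ∑ R ∈ P, a R * (chi R x * chi T x) := by
    funext x
    rw [Finset.sum_mul]
    exact Finset.sum_congr rfl fun _ _ => by ring
  rw [this, aux_E_sum]
  simp_rw [aux_E_mul, aux_orth]
  simp [hT]

theorem aux_inner {n : ℕ} (P : Finset (Finset (Fin n))) (a : Finset (Fin n) → ℝ)
    (f : (Fin n → Bool) → ℝ) :
    expectCube (fun x => f x * ∑ R ∈ P, a R * chi R x) = ∑ R ∈ P, a R * fhat f R := by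
  have : (fun x : Fin n → Bool => f x * ∑ R ∈ P, a R * chi R x) =
      fun x => ∑ R ∈ P, a R * (f x * chi R x) := by
    funext x
    rw [Finset.mul_sum]
    exact Finset.sum_congr rfl fun _ _ => by ring
  rw [this, aux_E_sum]
  simp_rw [aux_E_mul]
  rfl

theorem aux_parseval {n : ℕ} (P : Finset (Finset (Fin n))) (a : Finset (Fin n) → ℝ) :
    expectCube (fun x => (∑ R ∈ P, a R * chi R x) ^ 2) = ∑ R ∈ P, a R ^ 2 := by
  simp_rw [pow_two]
  rw [aux_inner P a (fun x => ∑ R ∈ P, a R * chi R x)]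
  exact Finset.sum_congr rfl fun R hR => by rw [aux_coef P a R hR]

theorem aux_bessel {n : ℕ} (P : Finset (Finset (Fin n))) (f : (Fin n → Bool) → ℝ) :
    ∑ R ∈ P, fhat f R ^ 2 ≤ expectCube (fun x => f x ^ 2) := by
  have h1 := aux_parseval P (fhat f)
  have h2 := aux_inner P (fhat f) f
  have h3 : expectCube (fun _ : Fin n → Bool => (0 : ℝ)) ≤
      expectCube (fun x => (f x ^ 2 - 2 * (f x * ∑ R ∈ P, fhat f R * chi R x))
        - (-1) * (∑ R ∈ P, fhat f R * chi R x) ^ 2) := by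
    apply aux_E_mono
    intro x
    nlinarith [sq_nonneg (f x - ∑ R ∈ P, fhat f R * chi R x)]
  rw [aux_E_const, aux_E_sub, aux_E_sub, aux_E_mul, aux_E_mul, h1, h2] at h3
  simp_rw [← pow_two] at h3
  linarith

theorem aux_jensen {n : ℕ} (F : (Fin n → Bool) → ℝ) :
    expectCube (fun x => |F x|) ^ 2 ≤ expectCube (fun x => F x ^ 2) := by
  set m := expectCube (fun x => |F x|) with hm
  have h3 : expectCube (fun _ : Fin n → Bool => (0 : ℝ)) ≤
      expectCube (fun x => (F x ^ 2 - (2 * m) * |F x|) - (- m ^ 2)) := by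
    apply aux_E_mono
    intro x
    nlinarith [sq_nonneg (|F x| - m), sq_abs (F x)]
  rw [aux_E_const, aux_E_sub, aux_E_sub, aux_E_mul, aux_E_const, ← hm] at h3
  nlinarith

/-- Let `f : {−1,1}^n → ℝ` with `E[f²] ≤ 1`, `C ⊆ U ⊆ [n]`, `ℓ ≥ 0`,
`ε ∈ (0,1)`.  Let `μ(S) ∈ [0,1]` satisfy `1 − μ(S) ≤ ε/√20` whenever `|S \ C| ≤ ℓ`, and
suppose `Σ_{R⊆U, |R\C|>ℓ} f̂(R)² ≤ ε²/5`.  Define `g(x) = Σ_S μ(S) f̂(S) χ_S(x)`.  Then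
`| E_x|Σ_{R⊆U} f̂(R)χ_R(x)| − E_x|Σ_{R⊆U} ĝ(R)χ_R(x)| | ≤ ε/2`. -/
theorem sharpnoise_preserves_junta_correlation (n : ℕ) (f : (Fin n → Bool) → ℝ)
    (hf : expectCube (fun x => f x ^ 2) ≤ 1)
    (U C : Finset (Fin n)) (hCU : C ⊆ U) (ℓ : ℕ)
    (ε : ℝ) (hε0 : 0 < ε) (hε1 : ε < 1)
    (μ : Finset (Fin n) → ℝ) (hμ : ∀ S, 0 ≤ μ S ∧ μ S ≤ 1)
    (hμlow : ∀ S : Finset (Fin n), (S \ C).card ≤ ℓ → 1 - μ S ≤ ε / Real.sqrt 20)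
    (hmass : ∑ R ∈ U.powerset.filter (fun R => ℓ < (R \ C).card), (fhat f R) ^ 2 ≤ ε ^ 2 / 5)
    (g : (Fin n → Bool) → ℝ)
    (hg : ∀ x, g x = ∑ S : Finset (Fin n), μ S * fhat f S * chi S x) :
    abs (expectCube (fun x => |∑ R ∈ U.powerset, fhat f R * chi R x|) -
        expectCube (fun x => |∑ R ∈ U.powerset, fhat g R * chi R x|)) ≤ ε / 2 := by
  have hgc : ∀ R, fhat g R = μ R * fhat f R := by
    intro R
    have : g = fun x => ∑ S ∈ (Finset.univ : Finset (Finset (Fin n))), (μ S * fhat f S) * chi S x :=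
      funext hg
    rw [this]
    exact aux_coef Finset.univ (fun S => μ S * fhat f S) R (Finset.mem_univ R)
  set D : (Fin n → Bool) → ℝ := fun x =>
    ∑ R ∈ U.powerset, ((1 - μ R) * fhat f R) * chi R x with hD
  have hdiff : ∀ x, D x = (∑ R ∈ U.powerset, fhat f R * chi R x) -
      ∑ R ∈ U.powerset, fhat g R * chi R x := by
    intro x
    rw [hD, ← Finset.sum_sub_distrib]
    exact Finset.sum_congr rfl fun R _ => by rw [hgc]; ring
  have hE2 : expectCube (fun x => D x ^ 2) ≤ (ε / 2) ^ 2 := by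
    rw [hD, aux_parseval, ← Finset.sum_filter_add_sum_filter_not _ (fun R => ℓ < (R \ C).card)]
    have hA : ∑ R ∈ U.powerset.filter (fun R => ℓ < (R \ C).card), ((1 - μ R) * fhat f R) ^ 2
        ≤ ε ^ 2 / 5 := by
      refine le_trans (Finset.sum_le_sum fun R _ => ?_) hmass
      rw [mul_pow]
      have := hμ R
      have h1 : (1 - μ R) ^ 2 ≤ 1 := by nlinarith
      nlinarith [sq_nonneg (fhat f R)]
    have hB : ∑ R ∈ U.powerset.filter (fun R => ¬ ℓ < (R \ C).card), ((1 - μ R) * fhat f R) ^ 2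
        ≤ ε ^ 2 / 20 := by
      have hb := (aux_bessel (U.powerset.filter (fun R => ¬ ℓ < (R \ C).card)) f).trans hf
      calc _ ≤ ∑ R ∈ U.powerset.filter (fun R => ¬ ℓ < (R \ C).card),
              ε ^ 2 / 20 * fhat f R ^ 2 := by
            refine Finset.sum_le_sum fun R hR => ?_
            have hc := hμlow R (not_lt.mp (Finset.mem_filter.mp hR).2)
            have h0 : 0 ≤ 1 - μ R := by linarith [(hμ R).2]
            have h1 : (1 - μ R) ^ 2 ≤ ε ^ 2 / 20 := by
              calc (1 - μ R) ^ 2 ≤ (ε / Real.sqrt 20) ^ 2 := by gcongr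
                _ = ε ^ 2 / 20 := by rw [div_pow, Real.sq_sqrt (by norm_num)]
            rw [mul_pow]
            gcongr
        _ ≤ ε ^ 2 / 20 := by
            rw [← Finset.mul_sum]
            exact mul_le_of_le_one_right (by positivity) hb
    linarith
  have hE1 : expectCube (fun x => |D x|) ≤ ε / 2 :=
    le_of_abs_le (abs_le_of_sq_le_sq ((aux_jensen D).trans hE2) (by positivity))
  have hX := aux_E_mono (fun x => |∑ R ∈ U.powerset, fhat f R * chi R x| -
      |∑ R ∈ U.powerset, fhat g R * chi R x|) (fun x => |D x|) (fun x => by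
        rw [hdiff]; exact abs_sub_abs_le_abs_sub _ _)
  have hY := aux_E_mono (fun x => |∑ R ∈ U.powerset, fhat g R * chi R x| -
      |∑ R ∈ U.powerset, fhat f R * chi R x|) (fun x => |D x|) (fun x => by
        rw [hdiff, abs_sub_comm]; exact abs_sub_abs_le_abs_sub _ _)
  rw [aux_E_sub] at hX hY
  rw [abs_le]
  constructor <;> linarith
end

section
/- Let f : {−1,1}^n → ℝ, let D ⊆ [n] be nonempty, let δ ∈ (0,1], and let m ≥ 1. Let i₁, …, i_m be drawn independently and uniformly at random from D and set I = {i₁, …, i_m}. For a set I ⊆ [n] let f_ave^I : {−1,1}^n → ℝ be defined by f_ave^I(x) := E_y[f(y) | y_j = x_j for all j ∉ I] (the average of f over the coordinates in I), whose Fourier coefficients satisfy f̂_ave^I(S) = f̂(S) if S ∩ I = ∅ and f̂_ave^I(S) = 0 otherwise. Then E_I[ Σ_{S ⊆ [n] : |S ∩ D| ≥ δ·|D|} (f̂_ave^I(S))² ] ≤ (1 − δ)^m · Σ_{S⊆[n]} f̂(S)². -/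
/-- `f_ave^I(x)`: the average of `f` over the coordinates in `I`, i.e.
`E_y[f(y) ∣ y_j = x_j for all j ∉ I]`. -/
noncomputable def fave {n : ℕ} (f : (Fin n → Bool) → ℝ) (I : Finset (Fin n))
    (x : Fin n → Bool) : ℝ :=
  (∑ y : Fin n → Bool, if ∀ j ∉ I, y j = x j then f y else 0) / 2 ^ I.card

lemma sum_chi_agree {n : ℕ} (I S : Finset (Fin n)) (y : Fin n → Bool) :
    (∑ x : Fin n → Bool, if ∀ j ∉ I, y j = x j then chi S x else 0) =
      if Disjoint S I then 2 ^ I.card * chi S y else 0 := by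
  have h1 : ∀ x : Fin n → Bool, (if ∀ j ∉ I, y j = x j then chi S x else 0) =
      ∏ j, ((if j ∈ I then 1 else if y j = x j then 1 else 0) *
        (if j ∈ S then sgnB (x j) else 1)) := by
    intro x
    rw [Finset.prod_mul_distrib, Finset.prod_ite_mem, Finset.univ_inter]
    change _ = _ * chi S x
    split_ifs with h
    · rw [Finset.prod_eq_one, one_mul]
      intro j _
      by_cases hj : j ∈ I
      · simp [hj]
      · simp [hj, h j hj]
    · push Not at h
      obtain ⟨j, hj, hne⟩ := h
      rw [Finset.prod_eq_zero (Finset.mem_univ j), zero_mul]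
      simp [hj, hne]
  rw [Finset.sum_congr rfl (fun x _ => h1 x)]
  have h2 := Finset.prod_univ_sum (fun _ : Fin n => (Finset.univ : Finset Bool))
    (fun j b => ((if j ∈ I then (1 : ℝ) else if y j = b then 1 else 0) *
        (if j ∈ S then sgnB b else 1)))
  rw [Fintype.piFinset_univ] at h2
  rw [← h2]
  have h3 : ∀ j, (∑ b : Bool, ((if j ∈ I then (1 : ℝ) else if y j = b then 1 else 0) *
        (if j ∈ S then sgnB b else 1))) =
      (if j ∈ I then (if j ∈ S then 0 else 2) else 1) * (if j ∈ S then sgnB (y j) else 1) := by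
    intro j
    rw [Fintype.sum_bool]
    by_cases hI : j ∈ I <;> by_cases hS : j ∈ S <;> cases y j <;>
      simp [hI, hS, sgnB] <;> norm_num
  rw [Finset.prod_congr rfl (fun j _ => h3 j), Finset.prod_mul_distrib,
    Finset.prod_ite_mem Finset.univ S, Finset.univ_inter]
  change _ * chi S y = _
  rw [Finset.prod_ite_mem, Finset.univ_inter]
  split_ifs with h
  · congr 1
    rw [← Finset.prod_const]
    refine Finset.prod_congr rfl fun j hj => ?_
    rw [if_neg (fun hS => Finset.disjoint_left.mp h hS hj)]
  · rw [Finset.not_disjoint_iff] at h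
    obtain ⟨j, hS, hI⟩ := h
    rw [Finset.prod_eq_zero hI (by simp [hS]), zero_mul]

lemma fhat_fave {n : ℕ} (f : (Fin n → Bool) → ℝ) (I S : Finset (Fin n)) :
    fhat (fave f I) S = if Disjoint S I then fhat f S else 0 := by
  have h : (∑ x : Fin n → Bool, fave f I x * chi S x) =
      ∑ y : Fin n → Bool, f y * (if Disjoint S I then chi S y else 0) := by
    have h1 : ∀ x : Fin n → Bool, fave f I x * chi S x =
        ∑ y : Fin n → Bool, f y / 2 ^ I.card * (if ∀ j ∉ I, y j = x j then chi S x else 0) := by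
      intro x
      unfold fave
      rw [Finset.sum_div, Finset.sum_mul]
      refine Finset.sum_congr rfl fun y _ => ?_
      split_ifs <;> simp
    rw [Finset.sum_congr rfl (fun x _ => h1 x), Finset.sum_comm]
    refine Finset.sum_congr rfl fun y _ => ?_
    rw [← Finset.mul_sum, sum_chi_agree]
    split_ifs
    · field_simp
    · simp
  unfold fhat expectCube
  rw [h]
  split_ifs <;> simp

open scoped Classical in
/-- Let `f : {−1,1}^n → ℝ`, `∅ ≠ D ⊆ [n]`, `δ ∈ (0,1]`, `m ≥ 1`.  Draw
`i₁, …, i_m` i.i.d. uniform from `D` and set `I = {i₁, …, i_m}`.  Then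
`E_I[ Σ_{S : |S∩D| ≥ δ·|D|} (f̂_ave^I(S))² ] ≤ (1 − δ)^m · Σ_S f̂(S)²`. -/
theorem averaging_attenuates_heavy_sets (n : ℕ) (f : (Fin n → Bool) → ℝ)
    (D : Finset (Fin n)) (hD : D.Nonempty)
    (δ : ℝ) (hδ0 : 0 < δ) (hδ1 : δ ≤ 1) (m : ℕ) (hm : 1 ≤ m) :
    (∑ a : Fin m → Fin n,
        if ∀ j : Fin m, a j ∈ D then
          ((D.card : ℝ))⁻¹ ^ m *
            ∑ S ∈ Finset.univ.filter
                (fun S : Finset (Fin n) => δ * (D.card : ℝ) ≤ ((S ∩ D).card : ℝ)),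
              (fhat (fave f (Finset.image a Finset.univ)) S) ^ 2
        else 0) ≤
      (1 - δ) ^ m * ∑ S : Finset (Fin n), (fhat f S) ^ 2 := by
  have hd : (0 : ℝ) < D.card := by exact_mod_cast hD.card_pos
  have e : ∀ a : Fin m → Fin n, (if ∀ j : Fin m, a j ∈ D then
          ((D.card : ℝ))⁻¹ ^ m *
            ∑ S ∈ Finset.univ.filter
                (fun S : Finset (Fin n) => δ * (D.card : ℝ) ≤ ((S ∩ D).card : ℝ)),
              (fhat (fave f (Finset.image a Finset.univ)) S) ^ 2
        else 0) = ∑ S ∈ Finset.univ.filter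
                (fun S : Finset (Fin n) => δ * (D.card : ℝ) ≤ ((S ∩ D).card : ℝ)),
          (((D.card : ℝ))⁻¹ ^ m * (fhat f S) ^ 2) *
            (if a ∈ Fintype.piFinset (fun _ : Fin m => D \ S) then 1 else 0) := by
    intro a
    split_ifs with ha
    · rw [Finset.mul_sum]
      refine Finset.sum_congr rfl fun S _ => ?_
      rw [fhat_fave]
      have hiff : Disjoint S (Finset.image a Finset.univ) ↔
          a ∈ Fintype.piFinset (fun _ : Fin m => D \ S) := by
        rw [Finset.disjoint_right]
        simp [ha]
      by_cases hc : a ∈ Fintype.piFinset (fun _ : Fin m => D \ S)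
      · rw [if_pos hc, if_pos (hiff.2 hc), mul_one]
      · rw [if_neg hc, if_neg (fun h => hc (hiff.1 h))]; simp
    · symm
      refine Finset.sum_eq_zero fun S _ => ?_
      rw [if_neg, mul_zero]
      intro h
      exact ha fun j => (Finset.mem_sdiff.1 (Fintype.mem_piFinset.1 h j)).1
  rw [Finset.sum_congr rfl (fun a _ => e a), Finset.sum_comm, Finset.mul_sum]
  have hp : (0 : ℝ) ≤ (1 - δ) ^ m := pow_nonneg (by linarith) m
  refine le_trans (Finset.sum_le_sum (fun S hS => ?_))
    (Finset.sum_le_sum_of_subset_of_nonneg (Finset.filter_subset _ _)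
      (fun S _ _ => mul_nonneg hp (sq_nonneg _)))
  rw [← Finset.mul_sum, Finset.sum_boole, Finset.filter_univ_mem,
    Fintype.card_piFinset_const]
  have hS' := (Finset.mem_filter.1 hS).2
  have hc : ((D \ S).card : ℝ) + ((S ∩ D).card : ℝ) = D.card := by
    rw [Finset.inter_comm]
    exact_mod_cast Finset.card_sdiff_add_card_inter D S
  have hq : (D.card : ℝ)⁻¹ * ((D \ S).card : ℝ) ≤ 1 - δ := by
    rw [inv_mul_le_iff₀ hd]
    nlinarith
  push_cast
  calc (D.card : ℝ)⁻¹ ^ m * fhat f S ^ 2 * ((D \ S).card : ℝ) ^ m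
      = ((D.card : ℝ)⁻¹ * ((D \ S).card : ℝ)) ^ m * fhat f S ^ 2 := by rw [mul_pow]; ring
    _ ≤ (1 - δ) ^ m * fhat f S ^ 2 := by gcongr
end
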